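/- arXiv:2404.09168 — 6 statements merged into one kernel-verified Lean document; each statement's English description precedes it below -/
import Mathlib

section
/- Let H : ℝ² → ℝ be twice continuously differentiable with H(x) ≥ 0 for all x and with uniformly bounded Hessian, and suppose there are constants z₀ > 0 and a₁ > 0 such that the sublevel set {x ∈ ℝ² : H(x) ≤ z₀} is bounded and such that H(x) ≥ a₁|x|² for every x with H(x) ≥ z₀. Let ϑ : [0,∞) → (0,∞) be twice continuously differentiable and satisfy |z·ϑ″(z)| + |ϑ′(z)| ≤ C₀·ϑ(z) for all z ≥ 0 and some constant C₀ > 0. Then there exists a constant c > 0 such that Δ(ϑ∘H)(x) ≤ c·ϑ(H(x)) for all x ∈ ℝ², where Δ(ϑ∘H)(x) = ϑ″(H(x))·|∇H(x)|² + ϑ′(H(x))·ΔH(x) and Δ denotes the Laplacian ∂₁₁ + ∂₂₂ on ℝ². -/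
open Set

/-- First partial derivative on `ℝ × ℝ`. -/
noncomputable def p1 (f : ℝ × ℝ → ℝ) (x : ℝ × ℝ) : ℝ := deriv (fun t => f (t, x.2)) x.1

/-- Second partial derivative on `ℝ × ℝ`. -/
noncomputable def p2 (f : ℝ × ℝ → ℝ) (x : ℝ × ℝ) : ℝ := deriv (fun t => f (x.1, t)) x.2

/-- **Glaeser's inequality**: a nonnegative function on `ℝ` with second derivative at most `K`
satisfies `(g')² ≤ 2 K g`. -/
theorem glaeser_inequality {g g' g'' : ℝ → ℝ} {K : ℝ} (hK : 0 < K)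
    (hg : ∀ t, HasDerivAt g (g' t) t) (hg' : ∀ t, HasDerivAt g' (g'' t) t)
    (hg0 : ∀ t, 0 ≤ g t) (hg'' : ∀ t, g'' t ≤ K) (t : ℝ) :
    g' t ^ 2 ≤ 2 * K * g t := by
  have hu : ∀ s, HasDerivAt (fun s => K / 2 * s ^ 2 - g s) (K * s - g' s) s := fun s => by
    have h := ((hasDerivAt_pow 2 s).const_mul (K / 2)).sub (hg s)
    exact h.congr_deriv (by push_cast; ring)
  have hu' : Monotone (fun s => K * s - g' s) :=
    monotone_of_hasDerivAt_nonneg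
      (fun s => ((hasDerivAt_id s).const_mul K).sub (hg' s))
      (fun s => by simpa using hg'' s)
  have hderiv : deriv (fun s => K / 2 * s ^ 2 - g s) = fun s => K * s - g' s :=
    funext fun s => (hu s).deriv
  have hconv : ConvexOn ℝ univ (fun s => K / 2 * s ^ 2 - g s) :=
    Monotone.convexOn_univ_of_deriv (fun s => (hu s).differentiableAt) (hderiv ▸ hu')
  have taylor : ∀ d, g (t + d) ≤ g t + g' t * d + K / 2 * d ^ 2 := fun d => by
    rcases lt_trichotomy d 0 with hd | rfl | hd
    · have h := hconv.slope_le_of_hasDerivAt (mem_univ (t + d)) (mem_univ t) (by linarith) (hu t)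
      rw [slope_def_field, div_le_iff₀ (by linarith)] at h
      nlinarith
    · simp
    · have h := hconv.le_slope_of_hasDerivAt (mem_univ t) (mem_univ (t + d)) (by linarith) (hu t)
      rw [slope_def_field, le_div_iff₀ (by linarith)] at h
      nlinarith
  have h := (hg0 _).trans (taylor (-(g' t / K)))
  have h2 : g t + g' t * -(g' t / K) + K / 2 * (-(g' t / K)) ^ 2
      = (2 * K * g t - g' t ^ 2) / (2 * K) := by
    field_simp
    ring
  rw [h2] at h
  rw [le_div_iff₀ (by positivity)] at h
  linarith

/-- Along a line with direction of norm at most one, a nonnegative `C²` function with Hessian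
bounded by `K` satisfies Glaeser's inequality, and its second derivative is bounded by `K`. -/
theorem sq_deriv_le_and_abs_deriv_deriv_le_of_norm_iteratedFDeriv_le
    {E : Type*} [NormedAddCommGroup E] [NormedSpace ℝ E] {H : E → ℝ} (hH : ContDiff ℝ 2 H)
    (hH0 : ∀ x, 0 ≤ H x) {K : ℝ} (hK : 0 < K) (hHess : ∀ x, ‖iteratedFDeriv ℝ 2 H x‖ ≤ K)
    {L : ℝ → E} {e : E} (he : ‖e‖ ≤ 1) (hL : ∀ t, HasDerivAt L e t) (t : ℝ) :
    deriv (fun s => H (L s)) t ^ 2 ≤ 2 * K * H (L t) ∧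
      |deriv (fun s => deriv (fun r => H (L r)) s) t| ≤ K := by
  have h1 : ∀ s, HasDerivAt (fun s => H (L s)) (fderiv ℝ H (L s) e) s := fun s =>
    ((hH.differentiable (by norm_num)) (L s)).hasFDerivAt.comp_hasDerivAt s (hL s)
  have hH' : Differentiable ℝ (fderiv ℝ H) :=
    (hH.fderiv_right (m := 1) (by norm_num)).differentiable (by norm_num)
  have h2 : ∀ s, HasDerivAt (fun s => fderiv ℝ H (L s) e)
      (fderiv ℝ (fderiv ℝ H) (L s) e e) s := fun s => by
    have := ((hH' (L s)).hasFDerivAt.comp_hasDerivAt s (hL s)).clm_apply (hasDerivAt_const s e)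
    simpa using this
  have hb : ∀ s, |fderiv ℝ (fderiv ℝ H) (L s) e e| ≤ K := fun s => by
    have h := (iteratedFDeriv ℝ 2 H (L s)).le_opNorm ![e, e]
    simp only [iteratedFDeriv_two_apply, Fin.prod_univ_two, Matrix.cons_val_zero,
      Matrix.cons_val_one, Real.norm_eq_abs] at h
    calc _ ≤ _ := h
      _ ≤ K * (1 * 1) := by gcongr; exact hHess _
      _ = K := by ring
  have hderiv : deriv (fun s => H (L s)) = fun s => fderiv ℝ H (L s) e :=
    funext fun s => (h1 s).deriv
  refine ⟨?_, ?_⟩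
  · rw [hderiv]
    exact glaeser_inequality hK h1 h2 (fun s => hH0 _) (fun s => (le_abs_self _).trans (hb s)) t
  · rw [hderiv, (h2 t).deriv]
    exact hb t

theorem stmt_0 (H : ℝ × ℝ → ℝ) (hH : ContDiff ℝ 2 H) (hH0 : ∀ x, 0 ≤ H x)
    (K : ℝ) (hHess : ∀ x, ‖iteratedFDeriv ℝ 2 H x‖ ≤ K)
    (z₀ a₁ : ℝ) (hz₀ : 0 < z₀) (ha₁ : 0 < a₁)
    (hbdd : Bornology.IsBounded {x : ℝ × ℝ | H x ≤ z₀})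
    (hquad : ∀ x : ℝ × ℝ, z₀ ≤ H x → a₁ * (x.1 ^ 2 + x.2 ^ 2) ≤ H x)
    (ϑ : ℝ → ℝ) (hϑ : ContDiffOn ℝ 2 ϑ (Ici 0))
    (hϑpos : ∀ z ∈ Ici (0:ℝ), 0 < ϑ z)
    (C₀ : ℝ) (hC₀ : 0 < C₀)
    (hϑbd : ∀ z ∈ Ici (0:ℝ),
      |z * derivWithin (derivWithin ϑ (Ici 0)) (Ici 0) z|
        + |derivWithin ϑ (Ici 0) z| ≤ C₀ * ϑ z) :
    ∃ c > 0, ∀ x : ℝ × ℝ,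
      derivWithin (derivWithin ϑ (Ici 0)) (Ici 0) (H x) * ((p1 H x) ^ 2 + (p2 H x) ^ 2)
        + derivWithin ϑ (Ici 0) (H x) * (p1 (p1 H) x + p2 (p2 H) x)
      ≤ c * ϑ (H x) := by
  obtain ⟨M, hM, hMH⟩ : ∃ M > 0, ∀ x, ‖iteratedFDeriv ℝ 2 H x‖ ≤ M :=
    ⟨max K 1, by positivity, fun x => (hHess x).trans (le_max_left _ _)⟩
  have he1 : ‖((1 : ℝ), (0 : ℝ))‖ ≤ 1 := by simp [Prod.norm_def]
  have he2 : ‖((0 : ℝ), (1 : ℝ))‖ ≤ 1 := by simp [Prod.norm_def]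
  refine ⟨6 * M * C₀, by positivity, fun x => ?_⟩
  obtain ⟨g1, b1⟩ := sq_deriv_le_and_abs_deriv_deriv_le_of_norm_iteratedFDeriv_le hH hH0 hM hMH
    he1 (fun t => (hasDerivAt_id t).prodMk (hasDerivAt_const t x.2)) x.1
  obtain ⟨g2, b2⟩ := sq_deriv_le_and_abs_deriv_deriv_le_of_norm_iteratedFDeriv_le hH hH0 hM hMH
    he2 (fun t => (hasDerivAt_const t x.1).prodMk (hasDerivAt_id t)) x.2
  change p1 H x ^ 2 ≤ 2 * M * H x at g1
  change p2 H x ^ 2 ≤ 2 * M * H x at g2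
  change |p1 (p1 H) x| ≤ M at b1
  change |p2 (p2 H) x| ≤ M at b2
  have hb := hϑbd (H x) (hH0 x)
  set A := derivWithin (derivWithin ϑ (Ici 0)) (Ici 0) (H x)
  set B := derivWithin ϑ (Ici 0) (H x)
  rw [abs_mul, abs_of_nonneg (hH0 x)] at hb
  have t1 : A * (p1 H x ^ 2 + p2 H x ^ 2) ≤ 4 * M * (H x * |A|) :=
    calc _ ≤ |A| * (p1 H x ^ 2 + p2 H x ^ 2) := by gcongr; exact le_abs_self A
      _ ≤ |A| * (2 * M * H x + 2 * M * H x) := by gcongr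
      _ = _ := by ring
  have t2 : B * (p1 (p1 H) x + p2 (p2 H) x) ≤ 2 * M * |B| :=
    calc _ ≤ |B| * |p1 (p1 H) x + p2 (p2 H) x| := (le_abs_self _).trans (abs_mul _ _).le
      _ ≤ |B| * (M + M) := by gcongr; exact (abs_add_le _ _).trans (add_le_add b1 b2)
      _ = _ := by ring
  have hA : 0 ≤ H x * |A| := mul_nonneg (hH0 x) (abs_nonneg A)
  calc _ ≤ 4 * M * (H x * |A|) + 2 * M * |B| := add_le_add t1 t2
    _ ≤ 6 * M * (H x * |A| + |B|) := by
        nlinarith [mul_nonneg hM.le hA, mul_nonneg hM.le (abs_nonneg B)]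
    _ ≤ 6 * M * (C₀ * ϑ (H x)) := by gcongr
    _ = _ := by ring
end

section
/- Let ζ : [0,∞) → ℝ be three times continuously differentiable with ζ(0) = 0, and suppose there are constants 0 ≤ r₀ < 1 and r̃₀ > 0 with −r₀ ≤ ζ′(z) ≤ r̃₀ for all z ≥ 0, constants r₂, r₃ > 0 with |ζ″(z)| ≤ r₂ and |z·ζ‴(z)| ≤ r₃ for all z ≥ 0, and constants r₁ ≥ 0 and Z₀ ≥ 0 with |z·ζ″(z)| ≤ r₁ for all z ≥ Z₀. Let F be the inverse of z ↦ z + ζ(z) on [0,∞), T(z) := π/(1 + ζ′(F(z))), and A(z) := 2π·F(z)·(1 + ζ′(F(z))). Then there exists a constant C > 0 such that for all z ≥ 0: |T′(z)| + |A′(z)| ≤ C and |A″(z)| + |A(z)·T′(z)| ≤ C. -/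
open Set Filter Topology

/-- A function on `[0, ∞)` whose derivative is at least `d` expands distances by at least `d`. -/
lemma mul_abs_sub_le_of_hasDerivWithinAt_Ici {g g' : ℝ → ℝ} {d : ℝ}
    (hg : ∀ x ∈ Ici (0:ℝ), HasDerivWithinAt g (g' x) (Ici 0) x)
    (hd : ∀ x ∈ Ici (0:ℝ), d ≤ g' x) {x y : ℝ} (hx : x ∈ Ici (0:ℝ)) (hy : y ∈ Ici (0:ℝ)) :
    d * |x - y| ≤ |g x - g y| := by
  have hmono : MonotoneOn (fun x => g x - d * x) (Ici 0) := by
    have h : ∀ x ∈ Ici (0:ℝ), HasDerivWithinAt (fun x => g x - d * x) (g' x - d) (Ici 0) x := by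
      intro x hx
      simpa using (hg x hx).fun_sub ((hasDerivWithinAt_id x (Ici 0)).const_mul d)
    refine monotoneOn_of_hasDerivWithinAt_nonneg (convex_Ici 0)
      (fun x hx => (h x hx).continuousWithinAt)
      (fun x hx => (h x (interior_subset hx)).mono interior_subset) ?_
    intro x hx
    linarith [hd x (interior_subset hx)]
  rcases le_total x y with hxy | hxy
  · have := hmono hx hy hxy
    rw [abs_sub_comm, abs_of_nonneg (sub_nonneg.2 hxy), abs_sub_comm]
    exact le_trans (by simp only at this; linarith) (le_abs_self _)
  · have := hmono hy hx hxy
    rw [abs_of_nonneg (sub_nonneg.2 hxy)]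
    exact le_trans (by simp only at this; linarith) (le_abs_self _)

/-- A right inverse on `[0, ∞)` of a function with derivative bounded below by `d > 0` is
differentiable, with the reciprocal derivative. -/
lemma hasDerivWithinAt_Ici_of_rightInverse {g g' F : ℝ → ℝ} {d : ℝ} (hd0 : 0 < d)
    (hg : ∀ x ∈ Ici (0:ℝ), HasDerivWithinAt g (g' x) (Ici 0) x)
    (hd : ∀ x ∈ Ici (0:ℝ), d ≤ g' x)
    (hF : ∀ z ∈ Ici (0:ℝ), F z ∈ Ici (0:ℝ)) (hgF : ∀ z ∈ Ici (0:ℝ), g (F z) = z)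
    {z : ℝ} (hz : z ∈ Ici (0:ℝ)) :
    HasDerivWithinAt F (g' (F z))⁻¹ (Ici 0) z := by
  have hcont : ContinuousWithinAt F (Ici 0) z := by
    rw [Metric.continuousWithinAt_iff]
    intro ε hε
    refine ⟨d * ε, by positivity, fun {w} hw hwz => ?_⟩
    have h := mul_abs_sub_le_of_hasDerivWithinAt_Ici hg hd (hF w hw) (hF z hz)
    rw [hgF w hw, hgF z hz] at h
    rw [Real.dist_eq] at hwz ⊢
    exact lt_of_mul_lt_mul_left (h.trans_lt hwz) hd0.le
  have hne : g' (F z) ≠ 0 := (hd0.trans_le (hd _ (hF z hz))).ne'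
  have hright : ∀ᶠ w in 𝓝[Ici 0] z, g (F w) = w :=
    eventually_nhdsWithin_of_forall hgF
  have hf : HasFDerivWithinAt g
      (ContinuousLinearEquiv.unitsEquivAut ℝ (Units.mk0 (g' (F z)) hne) : ℝ →L[ℝ] ℝ)
      (Ici 0) (F z) := by
    refine (hg _ (hF z hz)).hasFDerivWithinAt.congr_fderiv ?_
    ext
    simp
  have key := HasFDerivWithinAt.of_local_left_inverse
    (tendsto_nhdsWithin_iff.2 ⟨hcont, eventually_nhdsWithin_of_forall hF⟩) hf hz hright
  have := key.hasDerivWithinAt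
  simpa using this

/-- Two functions agreeing on `[0, ∞)` have the same one-sided derivatives there. -/
lemma HasDerivWithinAt.eq_of_eqOn_Ici {f g : ℝ → ℝ} {f' g' z : ℝ} (hz : z ∈ Ici (0:ℝ))
    (hf : HasDerivWithinAt f f' (Ici 0) z) (hg : HasDerivWithinAt g g' (Ici 0) z)
    (hfg : ∀ w ∈ Ici (0:ℝ), f w = g w) : f' = g' :=
  (uniqueDiffOn_Ici (0:ℝ) z hz).eq_deriv _ hf (hg.congr hfg (hfg z hz))

/-- If `f` is bounded and `x * f x` is bounded near infinity, then `x * f x` is bounded on `[0, ∞)`. -/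
lemma abs_mul_le_add_of_bound_of_tail {f : ℝ → ℝ} {r R Z : ℝ} (hR : 0 ≤ R) (hZ : 0 ≤ Z)
    (hf : ∀ x ∈ Ici (0:ℝ), |f x| ≤ r) (htail : ∀ x, Z ≤ x → |x * f x| ≤ R)
    {x : ℝ} (hx : x ∈ Ici (0:ℝ)) : |x * f x| ≤ R + Z * r := by
  have hr : 0 ≤ r := (abs_nonneg _).trans (hf x hx)
  rcases le_total Z x with h | h
  · exact (htail x h).trans (le_add_of_nonneg_right (mul_nonneg hZ hr))
  · rw [abs_mul, abs_of_nonneg (mem_Ici.1 hx)]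
    exact (mul_le_mul h (hf x hx) (abs_nonneg _) hZ).trans (le_add_of_nonneg_left hR)

theorem stmt_4 (ζ ζ' ζ'' ζ''' F T A T' A' A'' : ℝ → ℝ)
    (hζ0 : ζ 0 = 0)
    (hd1 : ∀ z ∈ Ici (0:ℝ), HasDerivWithinAt ζ (ζ' z) (Ici 0) z)
    (hd2 : ∀ z ∈ Ici (0:ℝ), HasDerivWithinAt ζ' (ζ'' z) (Ici 0) z)
    (hd3 : ∀ z ∈ Ici (0:ℝ), HasDerivWithinAt ζ'' (ζ''' z) (Ici 0) z)
    (hc3 : ContinuousOn ζ''' (Ici 0))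
    (r0 rt0 r1 r2 r3 Z0 : ℝ)
    (hr00 : 0 ≤ r0) (hr01 : r0 < 1) (hrt0 : 0 < rt0)
    (hr2 : 0 < r2) (hr3 : 0 < r3) (hr1 : 0 ≤ r1) (hZ0 : 0 ≤ Z0)
    (hlb : ∀ z ∈ Ici (0:ℝ), -r0 ≤ ζ' z)
    (hub : ∀ z ∈ Ici (0:ℝ), ζ' z ≤ rt0)
    (hb2 : ∀ z ∈ Ici (0:ℝ), |ζ'' z| ≤ r2)
    (hb3 : ∀ z ∈ Ici (0:ℝ), |z * ζ''' z| ≤ r3)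
    (hb1 : ∀ z, Z0 ≤ z → |z * ζ'' z| ≤ r1)
    (hF0 : ∀ z ∈ Ici (0:ℝ), 0 ≤ F z)
    (hinv : ∀ z ∈ Ici (0:ℝ), F z + ζ (F z) = z)
    (hT : ∀ z ∈ Ici (0:ℝ), T z = Real.pi / (1 + ζ' (F z)))
    (hA : ∀ z ∈ Ici (0:ℝ), A z = 2 * Real.pi * F z * (1 + ζ' (F z)))
    (hT' : ∀ z ∈ Ici (0:ℝ), HasDerivWithinAt T (T' z) (Ici 0) z)
    (hA' : ∀ z ∈ Ici (0:ℝ), HasDerivWithinAt A (A' z) (Ici 0) z)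
    (hA'' : ∀ z ∈ Ici (0:ℝ), HasDerivWithinAt A' (A'' z) (Ici 0) z) :
    ∃ C > 0, ∀ z ∈ Ici (0:ℝ),
      |T' z| + |A' z| ≤ C ∧ |A'' z| + |A z * T' z| ≤ C := by
  have hd0 : 0 < 1 - r0 := by linarith
  have hg : ∀ x ∈ Ici (0:ℝ), HasDerivWithinAt (fun x => x + ζ x) (1 + ζ' x) (Ici 0) x :=
    fun x hx => (hasDerivWithinAt_id x _).fun_add (hd1 x hx)
  have hq : ∀ x ∈ Ici (0:ℝ), 1 - r0 ≤ 1 + ζ' x := fun x hx => by linarith [hlb x hx]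
  have hqF : ∀ z ∈ Ici (0:ℝ), 1 + ζ' (F z) ≠ 0 :=
    fun z hz => (hd0.trans_le (hq _ (hF0 z hz))).ne'
  have hF : ∀ z ∈ Ici (0:ℝ), HasDerivWithinAt F (1 + ζ' (F z))⁻¹ (Ici 0) z :=
    fun z hz => hasDerivWithinAt_Ici_of_rightInverse hd0 hg hq hF0 hinv hz
  have hζ'F : ∀ z ∈ Ici (0:ℝ), HasDerivWithinAt (fun z => 1 + ζ' (F z))
      (ζ'' (F z) * (1 + ζ' (F z))⁻¹) (Ici 0) z :=
    fun z hz => ((hd2 _ (hF0 z hz)).comp z (hF z hz) hF0).const_add 1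
  have hζ''F : ∀ z ∈ Ici (0:ℝ), HasDerivWithinAt (fun z => ζ'' (F z))
      (ζ''' (F z) * (1 + ζ' (F z))⁻¹) (Ici 0) z :=
    fun z hz => (hd3 _ (hF0 z hz)).comp z (hF z hz) hF0
  have hinvF : ∀ z ∈ Ici (0:ℝ), HasDerivWithinAt (fun z => (1 + ζ' (F z))⁻¹)
      (-(ζ'' (F z) * (1 + ζ' (F z))⁻¹ ^ 3)) (Ici 0) z := fun z hz => by
    refine ((hζ'F z hz).fun_inv (hqF z hz)).congr_deriv ?_
    have := hqF z hz
    field_simp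
  have hT'_eq : ∀ z ∈ Ici (0:ℝ),
      T' z = -(Real.pi * (ζ'' (F z) * (1 + ζ' (F z))⁻¹ ^ 3)) := fun z hz => by
    rw [(hT' z hz).eq_of_eqOn_Ici hz ((hinvF z hz).const_mul Real.pi)
      fun w hw => by rw [hT w hw, div_eq_mul_inv]]
    ring
  have hA'_eq : ∀ z ∈ Ici (0:ℝ),
      A' z = 2 * Real.pi * (1 + F z * ζ'' (F z) * (1 + ζ' (F z))⁻¹) := fun z hz => by
    rw [(hA' z hz).eq_of_eqOn_Ici hz (((hF z hz).const_mul (2 * Real.pi)).fun_mul (hζ'F z hz)) hA]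
    have := hqF z hz
    field_simp
  have hA''_eq : ∀ z ∈ Ici (0:ℝ),
      A'' z = 2 * Real.pi * (ζ'' (F z) * (1 + ζ' (F z))⁻¹ ^ 2
        + F z * ζ''' (F z) * (1 + ζ' (F z))⁻¹ ^ 2
        - F z * ζ'' (F z) * ζ'' (F z) * (1 + ζ' (F z))⁻¹ ^ 3) := fun z hz => by
    rw [(hA'' z hz).eq_of_eqOn_Ici hz (((((hF z hz).fun_mul (hζ''F z hz)).fun_mul
      (hinvF z hz)).const_add 1).const_mul (2 * Real.pi)) hA'_eq]
    ring
  have hAT' : ∀ z ∈ Ici (0:ℝ), A z * T' z =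
      -(2 * Real.pi ^ 2 * (F z * ζ'' (F z) * (1 + ζ' (F z))⁻¹ ^ 2)) := fun z hz => by
    rw [hA z hz, hT'_eq z hz]
    have := hqF z hz
    field_simp
  set D := (1 - r0)⁻¹
  have hD0 : 0 < D := inv_pos.2 hd0
  set R := r1 + Z0 * r2
  have hR0 : 0 ≤ R := by positivity
  have hpi := Real.pi_pos
  refine ⟨Real.pi * (r2 * D ^ 3) + 2 * Real.pi * (1 + R * D)
    + (2 * Real.pi * (r2 * D ^ 2 + r3 * D ^ 2 + R * r2 * D ^ 3)
    + 2 * Real.pi ^ 2 * (R * D ^ 2)), by positivity, fun z hz => ?_⟩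
  have hx := hF0 z hz
  have hu0 : 0 < (1 + ζ' (F z))⁻¹ := inv_pos.2 (hd0.trans_le (hq _ hx))
  have huD : (1 + ζ' (F z))⁻¹ ≤ D := inv_anti₀ hd0 (hq _ hx)
  have ha := hb2 _ hx
  have hxb := hb3 _ hx
  have hxa : |F z * ζ'' (F z)| ≤ R := abs_mul_le_add_of_bound_of_tail hr1 hZ0 hb2 hb1 hx
  rw [hAT' z hz, hT'_eq z hz, hA'_eq z hz, hA''_eq z hz]
  generalize (1 + ζ' (F z))⁻¹ = u at *
  generalize F z * ζ''' (F z) = b at *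
  generalize F z * ζ'' (F z) = c at *
  generalize ζ'' (F z) = a at *
  have bound : ∀ {s S : ℝ} (n : ℕ), |s| ≤ S → |s * u ^ n| ≤ S * D ^ n := fun n hs => by
    rw [abs_mul, abs_of_pos (pow_pos hu0 n)]
    exact mul_le_mul hs (pow_le_pow_left₀ hu0.le huD n) (by positivity) ((abs_nonneg _).trans hs)
  have hca : |c * a| ≤ R * r2 := by
    rw [abs_mul]
    exact mul_le_mul hxa ha (abs_nonneg _) hR0
  have e1 : |-(Real.pi * (a * u ^ 3))| ≤ Real.pi * (r2 * D ^ 3) := by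
    rw [abs_neg, abs_mul, abs_of_pos hpi]
    gcongr
    exact bound 3 ha
  have e2 : |2 * Real.pi * (1 + c * u)| ≤ 2 * Real.pi * (1 + R * D) := by
    rw [abs_mul, abs_of_pos (by positivity : 0 < 2 * Real.pi)]
    gcongr
    refine (abs_add_le _ _).trans ?_
    simpa using bound 1 hxa
  have e3 : |2 * Real.pi * (a * u ^ 2 + b * u ^ 2 - c * a * u ^ 3)| ≤
      2 * Real.pi * (r2 * D ^ 2 + r3 * D ^ 2 + R * r2 * D ^ 3) := by
    rw [abs_mul, abs_of_pos (by positivity : 0 < 2 * Real.pi)]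
    gcongr
    refine (abs_sub _ _).trans (add_le_add ((abs_add_le _ _).trans ?_) (bound 3 hca))
    exact add_le_add (bound 2 ha) (bound 2 hxb)
  have e4 : |-(2 * Real.pi ^ 2 * (c * u ^ 2))| ≤ 2 * Real.pi ^ 2 * (R * D ^ 2) := by
    rw [abs_neg, abs_mul, abs_of_pos (by positivity : 0 < 2 * Real.pi ^ 2)]
    gcongr
    exact bound 2 hxa
  constructor
  · refine (add_le_add e1 e2).trans (le_add_of_nonneg_right ?_)
    positivity
  · refine (add_le_add e3 e4).trans (le_add_of_nonneg_left ?_)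
    positivity
end

section
/- Let ζ : [0,∞) → ℝ be twice continuously differentiable with ζ(0) = 0 and −r₀ ≤ ζ′(z) ≤ r̃₀ for all z ≥ 0 (0 ≤ r₀ < 1, r̃₀ > 0). Let F be the inverse of z ↦ z + ζ(z) on [0,∞), T(z) := π/(1 + ζ′(F(z))), A(z) := 2π·F(z)·(1 + ζ′(F(z))), and H(x) := |x|² + ζ(|x|²). Let R : [0,∞) → ℝ be twice continuously differentiable, let φ(x) := R(|x|²) and u(z) := R(F(z)). Then: (i) (1/2)·Δφ(x) = 2|x|²·R″(|x|²) + 2R′(|x|²) for all x ∈ ℝ²; (ii) u′(z) = R′(F(z))/(1 + ζ′(F(z))) and u″(z) = R″(F(z))/(1 + ζ′(F(z)))² − R′(F(z))·ζ″(F(z))/(1 + ζ′(F(z)))³; (iii) (A(z)/T(z))·u″(z) + (A′(z)/T(z))·u′(z) = 2F(z)·R″(F(z)) + 2R′(F(z)) for all z ≥ 0; and consequently (iv) for every ε > 0 and every x ∈ ℝ², (1/2)Δφ(x) + (1/ε)·⟨∇⊥H(x), ∇φ(x)⟩ = (A/T)(H(x))·u″(H(x)) + (A′/T)(H(x))·u′(H(x)).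 -/
open Set

open Filter Topology

/-- A one-sided version of the derivative rule for a continuous right inverse. -/
lemma hasDerivWithinAt_of_rightInverse {f g : ℝ → ℝ} {s t : Set ℝ} {f' a : ℝ}
    (hg : Tendsto g (𝓝[s] a) (𝓝[t] (g a))) (hf : HasDerivWithinAt f f' t (g a)) (hf' : f' ≠ 0)
    (ha : a ∈ s) (hfg : ∀ x ∈ s, f (g x) = x) : HasDerivWithinAt g f'⁻¹ s a := by
  have := (HasFDerivWithinAt.of_local_left_inverse
    (f' := ContinuousLinearEquiv.unitsEquivAut ℝ (Units.mk0 f' hf')) hg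
    (by simpa using! hf.hasFDerivWithinAt) ha
    (eventually_nhdsWithin_of_forall hfg)).hasDerivWithinAt
  simpa using! this

/-- A function on `[0, ∞)` whose derivative is bounded below by `c` expands increments by at least
`c`. -/
lemma mul_sub_le_of_hasDerivWithinAt_Ici {f f' : ℝ → ℝ} {c : ℝ}
    (hf : ∀ z ∈ Ici (0:ℝ), HasDerivWithinAt f (f' z) (Ici 0) z)
    (hc : ∀ z ∈ Ici (0:ℝ), c ≤ f' z) {x y : ℝ} (hx : 0 ≤ x) (hxy : x ≤ y) :
    c * (y - x) ≤ f y - f x := by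
  have hd : ∀ z ∈ interior (Ici (0:ℝ)), HasDerivAt f (f' z) z := fun z hz =>
    (hf z (interior_subset hz)).hasDerivAt (mem_interior_iff_mem_nhds.1 hz)
  exact (convex_Ici 0).mul_sub_le_image_sub_of_le_deriv
    (fun z hz => (hf z hz).continuousWithinAt)
    (fun z hz => (hd z hz).differentiableAt.differentiableWithinAt)
    (fun z hz => (hd z hz).deriv.symm ▸ hc z (interior_subset hz)) x hx y (hx.trans hxy) hxy

/-- A one-sided chain rule for radial functions along a coordinate line. -/
lemma hasDerivAt_comp_sq_add {R : ℝ → ℝ} {R' c t : ℝ} (hc : 0 ≤ c)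
    (hR : HasDerivWithinAt R R' (Ici 0) (t ^ 2 + c)) :
    HasDerivAt (fun s => R (s ^ 2 + c)) (R' * (2 * t)) t := by
  have h : HasDerivAt (fun s : ℝ => s ^ 2 + c) (2 * t) t := by
    simpa using ((hasDerivAt_id t).pow 2).add_const c
  exact hR.comp_hasDerivAt t h (Eventually.of_forall fun s => add_nonneg (sq_nonneg s) hc)

section Radial

variable {R R' R'' : ℝ → ℝ} {φ : ℝ × ℝ → ℝ}

lemma p1_radial (hR : ∀ z ∈ Ici (0:ℝ), HasDerivWithinAt R (R' z) (Ici 0) z)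
    (hφ : ∀ x : ℝ × ℝ, φ x = R (x.1 ^ 2 + x.2 ^ 2)) (x : ℝ × ℝ) :
    p1 φ x = R' (x.1 ^ 2 + x.2 ^ 2) * (2 * x.1) := by
  simp only [p1, hφ]
  exact (hasDerivAt_comp_sq_add (sq_nonneg _) (hR _ (mem_Ici.2 (by positivity)))).deriv

lemma p2_radial (hR : ∀ z ∈ Ici (0:ℝ), HasDerivWithinAt R (R' z) (Ici 0) z)
    (hφ : ∀ x : ℝ × ℝ, φ x = R (x.1 ^ 2 + x.2 ^ 2)) (x : ℝ × ℝ) :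
    p2 φ x = R' (x.1 ^ 2 + x.2 ^ 2) * (2 * x.2) := by
  simp only [p2, hφ, add_comm (x.1 ^ 2)]
  exact (hasDerivAt_comp_sq_add (sq_nonneg _) (hR _ (mem_Ici.2 (by positivity)))).deriv

lemma p1_p1_radial (hR : ∀ z ∈ Ici (0:ℝ), HasDerivWithinAt R (R' z) (Ici 0) z)
    (hR' : ∀ z ∈ Ici (0:ℝ), HasDerivWithinAt R' (R'' z) (Ici 0) z)
    (hφ : ∀ x : ℝ × ℝ, φ x = R (x.1 ^ 2 + x.2 ^ 2)) (x : ℝ × ℝ) :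
    p1 (p1 φ) x = R'' (x.1 ^ 2 + x.2 ^ 2) * (2 * x.1) * (2 * x.1)
      + R' (x.1 ^ 2 + x.2 ^ 2) * 2 := by
  rw [p1]
  simp only [p1_radial hR hφ]
  have h := (hasDerivAt_comp_sq_add (t := x.1) (sq_nonneg x.2)
    (hR' _ (mem_Ici.2 (by positivity)))).mul ((hasDerivAt_id x.1).const_mul 2)
  rw [mul_one] at h
  exact h.deriv

lemma p2_p2_radial (hR : ∀ z ∈ Ici (0:ℝ), HasDerivWithinAt R (R' z) (Ici 0) z)
    (hR' : ∀ z ∈ Ici (0:ℝ), HasDerivWithinAt R' (R'' z) (Ici 0) z)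
    (hφ : ∀ x : ℝ × ℝ, φ x = R (x.1 ^ 2 + x.2 ^ 2)) (x : ℝ × ℝ) :
    p2 (p2 φ) x = R'' (x.1 ^ 2 + x.2 ^ 2) * (2 * x.2) * (2 * x.2)
      + R' (x.1 ^ 2 + x.2 ^ 2) * 2 := by
  rw [p2]
  simp only [p2_radial hR hφ, add_comm (x.1 ^ 2)]
  have h := (hasDerivAt_comp_sq_add (t := x.2) (sq_nonneg x.1)
    (hR' _ (mem_Ici.2 (by positivity)))).mul ((hasDerivAt_id x.2).const_mul 2)
  rw [mul_one] at h
  exact h.deriv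

end Radial

theorem stmt_9 (ζ ζ' ζ'' F T A A' R R' R'' u u1 u2 : ℝ → ℝ) (H φ : ℝ × ℝ → ℝ)
    (hζ0 : ζ 0 = 0)
    (hd1 : ∀ z ∈ Ici (0:ℝ), HasDerivWithinAt ζ (ζ' z) (Ici 0) z)
    (hd2 : ∀ z ∈ Ici (0:ℝ), HasDerivWithinAt ζ' (ζ'' z) (Ici 0) z)
    (hc2 : ContinuousOn ζ'' (Ici 0))
    (r0 rt0 : ℝ) (hr00 : 0 ≤ r0) (hr01 : r0 < 1) (hrt0 : 0 < rt0)
    (hlb : ∀ z ∈ Ici (0:ℝ), -r0 ≤ ζ' z)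
    (hub : ∀ z ∈ Ici (0:ℝ), ζ' z ≤ rt0)
    (hF0 : ∀ z ∈ Ici (0:ℝ), 0 ≤ F z)
    (hinv : ∀ z ∈ Ici (0:ℝ), F z + ζ (F z) = z)
    (hT : ∀ z ∈ Ici (0:ℝ), T z = Real.pi / (1 + ζ' (F z)))
    (hA : ∀ z ∈ Ici (0:ℝ), A z = 2 * Real.pi * F z * (1 + ζ' (F z)))
    (hA' : ∀ z ∈ Ici (0:ℝ), HasDerivWithinAt A (A' z) (Ici 0) z)
    (hH : ∀ x : ℝ × ℝ, H x = x.1 ^ 2 + x.2 ^ 2 + ζ (x.1 ^ 2 + x.2 ^ 2))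
    (hR1 : ∀ z ∈ Ici (0:ℝ), HasDerivWithinAt R (R' z) (Ici 0) z)
    (hR2 : ∀ z ∈ Ici (0:ℝ), HasDerivWithinAt R' (R'' z) (Ici 0) z)
    (hRc : ContinuousOn R'' (Ici 0))
    (hφ : ∀ x : ℝ × ℝ, φ x = R (x.1 ^ 2 + x.2 ^ 2))
    (hu : ∀ z ∈ Ici (0:ℝ), u z = R (F z))
    (hu1 : ∀ z ∈ Ici (0:ℝ), u1 z = R' (F z) / (1 + ζ' (F z)))
    (hu2 : ∀ z ∈ Ici (0:ℝ),
      u2 z = R'' (F z) / (1 + ζ' (F z)) ^ 2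
        - R' (F z) * ζ'' (F z) / (1 + ζ' (F z)) ^ 3) :
    (∀ x : ℝ × ℝ,
      (1 / 2) * (p1 (p1 φ) x + p2 (p2 φ) x)
        = 2 * (x.1 ^ 2 + x.2 ^ 2) * R'' (x.1 ^ 2 + x.2 ^ 2)
          + 2 * R' (x.1 ^ 2 + x.2 ^ 2)) ∧
    (∀ z ∈ Ici (0:ℝ),
      HasDerivWithinAt u (u1 z) (Ici 0) z ∧ HasDerivWithinAt u1 (u2 z) (Ici 0) z) ∧
    (∀ z ∈ Ici (0:ℝ),
      (A z / T z) * u2 z + (A' z / T z) * u1 z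
        = 2 * F z * R'' (F z) + 2 * R' (F z)) ∧
    (∀ ε > (0:ℝ), ∀ x : ℝ × ℝ,
      (1 / 2) * (p1 (p1 φ) x + p2 (p2 φ) x)
          + (1 / ε) * ((-(p2 H x)) * p1 φ x + p1 H x * p2 φ x)
        = (A (H x) / T (H x)) * u2 (H x) + (A' (H x) / T (H x)) * u1 (H x)) := by
  have hdG : ∀ z ∈ Ici (0:ℝ), HasDerivWithinAt (fun y => y + ζ y) (1 + ζ' z) (Ici 0) z :=
    fun z hz => (hasDerivWithinAt_id z _).add (hd1 z hz)
  have hGlb : ∀ {x y : ℝ}, 0 ≤ x → x ≤ y → (1 - r0) * (y - x) ≤ (y + ζ y) - (x + ζ x) :=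
    fun hx hxy => mul_sub_le_of_hasDerivWithinAt_Ici hdG
      (fun z hz => by linarith [hlb z hz]) hx hxy
  have hr : 0 < 1 - r0 := by linarith
  have hGF : ∀ y, 0 ≤ y → 0 ≤ y + ζ y ∧ F (y + ζ y) = y := by
    intro y hy
    have hnn : 0 ≤ y + ζ y := by
      have h := hGlb le_rfl hy
      rw [hζ0] at h
      nlinarith [mul_nonneg hr.le hy]
    refine ⟨hnn, ?_⟩
    have e := hinv _ hnn
    have h0 := hF0 _ hnn
    rcases le_total (F (y + ζ y)) y with h | h
    · nlinarith [hGlb h0 h]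
    · nlinarith [hGlb hy h]
  have hFlip : ∀ a ∈ Ici (0:ℝ), ∀ b ∈ Ici (0:ℝ), |F b - F a| ≤ (1 - r0)⁻¹ * |b - a| := by
    intro a ha b hb
    rw [inv_mul_eq_div, le_div_iff₀ hr, mul_comm]
    have ea := hinv a ha
    have eb := hinv b hb
    rcases le_total (F a) (F b) with h | h
    · have := hGlb (hF0 a ha) h
      rw [abs_of_nonneg (sub_nonneg.2 h)]
      exact le_trans (by linarith) (le_abs_self _)
    · have := hGlb (hF0 b hb) h
      rw [abs_of_nonpos (sub_nonpos.2 h)]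
      exact le_trans (by linarith) (neg_le_abs _)
  have hFc : ContinuousOn F (Ici 0) :=
    (LipschitzOnWith.of_dist_le_mul (K := ⟨(1 - r0)⁻¹, (inv_pos.2 hr).le⟩)
      fun b hb a ha => hFlip a ha b hb).continuousOn
  have hpos : ∀ z ∈ Ici (0:ℝ), 0 < 1 + ζ' (F z) := fun z hz => by linarith [hlb _ (hF0 z hz)]
  have hdF : ∀ z ∈ Ici (0:ℝ), HasDerivWithinAt F (1 + ζ' (F z))⁻¹ (Ici 0) z := fun z hz =>
    hasDerivWithinAt_of_rightInverse ((hFc z hz).tendsto_nhdsWithin hF0)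
      (hdG _ (hF0 z hz)) (hpos z hz).ne' hz hinv
  have hdζF : ∀ z ∈ Ici (0:ℝ),
      HasDerivWithinAt (fun y => 1 + ζ' (F y)) (ζ'' (F z) * (1 + ζ' (F z))⁻¹) (Ici 0) z :=
    fun z hz => ((hd2 _ (hF0 z hz)).comp z (hdF z hz) hF0).const_add 1
  have hLap : ∀ x : ℝ × ℝ, (1 / 2) * (p1 (p1 φ) x + p2 (p2 φ) x)
      = 2 * (x.1 ^ 2 + x.2 ^ 2) * R'' (x.1 ^ 2 + x.2 ^ 2) + 2 * R' (x.1 ^ 2 + x.2 ^ 2) := by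
    intro x
    rw [p1_p1_radial hR1 hR2 hφ, p2_p2_radial hR1 hR2 hφ]
    ring
  have hgraph : ∀ z ∈ Ici (0:ℝ), (A z / T z) * u2 z + (A' z / T z) * u1 z
      = 2 * F z * R'' (F z) + 2 * R' (F z) := by
    intro z hz
    have hp := (hpos z hz).ne'
    have hAd := (((hdF z hz).const_mul (2 * Real.pi)).mul (hdζF z hz)).congr hA (hA z hz)
    rw [(uniqueDiffOn_Ici (0:ℝ) z hz).eq_deriv _ (hA' z hz) hAd, hA z hz, hT z hz, hu1 z hz,
      hu2 z hz]
    field_simp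
    ring
  refine ⟨hLap, fun z hz => ⟨?_, ?_⟩, hgraph, fun ε _ x => ?_⟩
  · rw [hu1 z hz, div_eq_mul_inv]
    exact ((hR1 _ (hF0 z hz)).comp z (hdF z hz) hF0).congr hu (hu z hz)
  · have hp := (hpos z hz).ne'
    refine ((((hR2 _ (hF0 z hz)).comp z (hdF z hz) hF0).div (hdζF z hz) hp).congr
      hu1 (hu1 z hz)).congr_deriv ?_
    rw [hu2 z hz, Function.comp_apply]
    field_simp
  · have hs : 0 ≤ x.1 ^ 2 + x.2 ^ 2 := by positivity
    obtain ⟨hH0, hFH⟩ := hGF _ hs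
    rw [← hH x] at hH0 hFH
    rw [hLap, hgraph _ hH0, hFH, p1_radial hR1 hφ, p2_radial hR1 hφ, p1_radial hdG hH,
      p2_radial hdG hH]
    ring
end

section
/- Let ζ : [0,∞) → ℝ be continuously differentiable with ζ(0) = 0 and −r₀ ≤ ζ′(z) ≤ r̃₀ for all z ≥ 0 (0 ≤ r₀ < 1, r̃₀ > 0), let F be the inverse of z ↦ z + ζ(z) on [0,∞), A(z) := 2π·F(z)·(1 + ζ′(F(z))), and H(x) := |x|² + ζ(|x|²). Let ϑ : [0,∞) → [0,∞) be measurable and u : [0,∞) → ℝ be continuously differentiable. Then, as an identity of (possibly infinite) integrals of nonnegative functions, ∫_{ℝ²} |∇(u∘H)(x)|²·ϑ(H(x)) dx = 2·∫₀^∞ |u′(z)|²·A(z)·ϑ(z) dz. -/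
open Set MeasureTheory

lemma lintegral_radial_sq {g : ℝ → ENNReal} (hg : Measurable fun r : ℝ => g (r ^ 2)) :
    ∫⁻ x : ℝ × ℝ, g (x.1 ^ 2 + x.2 ^ 2)
      = ENNReal.ofReal (2 * Real.pi) * ∫⁻ r in Ioi (0:ℝ), ENNReal.ofReal r * g (r ^ 2) := by
  have hsq : ∀ p : ℝ × ℝ,
      (polarCoord.symm p).1 ^ 2 + (polarCoord.symm p).2 ^ 2 = p.1 ^ 2 := fun p => by
    simp only [polarCoord_symm_apply]
    linear_combination p.1 ^ 2 * Real.cos_sq_add_sin_sq p.2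
  have hm : Measurable fun r : ℝ => ENNReal.ofReal r * g (r ^ 2) :=
    ENNReal.measurable_ofReal.mul hg
  rw [← lintegral_comp_polarCoord_symm]
  simp only [hsq, smul_eq_mul, polarCoord_target]
  rw [Measure.volume_eq_prod, ← Measure.prod_restrict,
    lintegral_prod (fun p : ℝ × ℝ => ENNReal.ofReal p.1 * g (p.1 ^ 2))
      (hm.comp measurable_fst).aemeasurable]
  simp only [lintegral_const, Measure.restrict_apply MeasurableSet.univ, univ_inter,
    Real.volume_Ioo]
  rw [lintegral_mul_const _ hm, mul_comm]
  congr 2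
  ring

lemma p1_comp_radial_sq {w : ℝ → ℝ} {w' : ℝ} {x : ℝ × ℝ}
    (hw : HasDerivAt w w' (x.1 ^ 2 + x.2 ^ 2)) :
    p1 (fun y => w (y.1 ^ 2 + y.2 ^ 2)) x = w' * (2 * x.1) := by
  have h : HasDerivAt (fun t : ℝ => t ^ 2 + x.2 ^ 2) (2 * x.1) x.1 := by
    simpa using (hasDerivAt_pow 2 x.1).add_const (x.2 ^ 2)
  exact (HasDerivAt.comp x.1 hw h).deriv

lemma p2_comp_radial_sq {w : ℝ → ℝ} {w' : ℝ} {x : ℝ × ℝ}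
    (hw : HasDerivAt w w' (x.1 ^ 2 + x.2 ^ 2)) :
    p2 (fun y => w (y.1 ^ 2 + y.2 ^ 2)) x = w' * (2 * x.2) := by
  have h : HasDerivAt (fun t : ℝ => x.1 ^ 2 + t ^ 2) (2 * x.2) x.2 := by
    simpa using (hasDerivAt_pow 2 x.2).const_add (x.1 ^ 2)
  exact (HasDerivAt.comp x.2 hw h).deriv

theorem stmt_10 (ζ ζ' F A ϑ u u' : ℝ → ℝ) (H : ℝ × ℝ → ℝ)
    (hζ0 : ζ 0 = 0)
    (hd1 : ∀ z ∈ Ici (0:ℝ), HasDerivWithinAt ζ (ζ' z) (Ici 0) z)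
    (hc1 : ContinuousOn ζ' (Ici 0))
    (r0 rt0 : ℝ) (hr00 : 0 ≤ r0) (hr01 : r0 < 1) (hrt0 : 0 < rt0)
    (hlb : ∀ z ∈ Ici (0:ℝ), -r0 ≤ ζ' z)
    (hub : ∀ z ∈ Ici (0:ℝ), ζ' z ≤ rt0)
    (hF0 : ∀ z ∈ Ici (0:ℝ), 0 ≤ F z)
    (hinv : ∀ z ∈ Ici (0:ℝ), F z + ζ (F z) = z)
    (hA : ∀ z ∈ Ici (0:ℝ), A z = 2 * Real.pi * F z * (1 + ζ' (F z)))
    (hH : ∀ x : ℝ × ℝ, H x = x.1 ^ 2 + x.2 ^ 2 + ζ (x.1 ^ 2 + x.2 ^ 2))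
    (hϑm : Measurable ϑ)
    (hϑ0 : ∀ z ∈ Ici (0:ℝ), 0 ≤ ϑ z)
    (hu : ∀ z ∈ Ici (0:ℝ), HasDerivWithinAt u (u' z) (Ici 0) z)
    (huc : ContinuousOn u' (Ici 0)) :
    (∫⁻ x : ℝ × ℝ,
        ENNReal.ofReal
          (((p1 (fun y => u (H y)) x) ^ 2 + (p2 (fun y => u (H y)) x) ^ 2) * ϑ (H x)))
      = 2 * ∫⁻ z in Ioi (0:ℝ), ENNReal.ofReal ((u' z) ^ 2 * A z * ϑ z) := by
  have hqd : ∀ z ∈ Ici (0:ℝ),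
      HasDerivWithinAt (fun s => s + ζ s) (1 + ζ' z) (Ici 0) z := fun z hz =>
    (hasDerivWithinAt_id z _).add (hd1 z hz)
  have hqpos : ∀ z ∈ Ici (0:ℝ), 0 < 1 + ζ' z := fun z hz => by linarith [hlb z hz]
  have hqcont : ContinuousOn (fun s => s + ζ s) (Ici 0) := fun z hz =>
    (hqd z hz).continuousWithinAt
  have hqat : ∀ z ∈ Ioi (0:ℝ), HasDerivAt (fun s => s + ζ s) (1 + ζ' z) z := fun z hz =>
    (hqd z (mem_Ici_of_Ioi hz)).hasDerivAt (Ici_mem_nhds hz)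
  have hmono : StrictMonoOn (fun s => s + ζ s) (Ici 0) := by
    refine strictMonoOn_of_deriv_pos (convex_Ici 0) hqcont fun z hz => ?_
    rw [interior_Ici] at hz
    rw [(hqat z hz).deriv]
    exact hqpos z (mem_Ici_of_Ioi hz)
  have hq_nonneg : ∀ s ∈ Ici (0:ℝ), 0 ≤ s + ζ s := fun s hs => by
    simpa [hζ0] using hmono.monotoneOn self_mem_Ici hs hs
  have hq_pos : ∀ s ∈ Ioi (0:ℝ), 0 < s + ζ s := fun s hs => by
    simpa [hζ0] using hmono self_mem_Ici (mem_Ici_of_Ioi hs) hs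
  have hFq : ∀ s ∈ Ici (0:ℝ), F (s + ζ s) = s := fun s hs =>
    hmono.injOn (hF0 _ (hq_nonneg s hs)) hs (hinv _ (hq_nonneg s hs))
  have hwd : ∀ s ∈ Ioi (0:ℝ),
      HasDerivAt (fun t => u (t + ζ t)) (u' (s + ζ s) * (1 + ζ' s)) s := fun s hs =>
    HasDerivAt.comp s ((hu _ (hq_nonneg s (mem_Ici_of_Ioi hs))).hasDerivAt
      (Ici_mem_nhds (hq_pos s hs))) (hqat s hs)
  let g : ℝ → ℝ := fun s => 4 * s * (u' (s + ζ s) * (1 + ζ' s)) ^ 2 * ϑ (s + ζ s)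
  have hsq : Continuous fun r : ℝ => r ^ 2 := continuous_pow 2
  have hqsq : Continuous fun r : ℝ => r ^ 2 + ζ (r ^ 2) :=
    hqcont.comp_continuous hsq fun r => sq_nonneg r
  have hgm : Measurable fun r : ℝ => ENNReal.ofReal (g (r ^ 2)) := by
    have hu'm : Measurable fun r : ℝ => u' (r ^ 2 + ζ (r ^ 2)) :=
      (huc.comp_continuous hqsq fun r => hq_nonneg _ (sq_nonneg r)).measurable
    have hζ'm : Measurable fun r : ℝ => ζ' (r ^ 2) :=
      (hc1.comp_continuous hsq fun r => sq_nonneg r).measurable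
    have hϑq : Measurable fun r : ℝ => ϑ (r ^ 2 + ζ (r ^ 2)) := hϑm.comp hqsq.measurable
    exact ENNReal.measurable_ofReal.comp
      (((hsq.measurable.const_mul 4).mul ((hu'm.mul (hζ'm.const_add 1)).pow_const 2)).mul hϑq)
  have hHeq : (fun y => u (H y)) = fun y : ℝ × ℝ =>
      (fun s => u (s + ζ s)) (y.1 ^ 2 + y.2 ^ 2) := by
    funext y
    rw [hH]
  have hlhs : (∫⁻ x : ℝ × ℝ, ENNReal.ofReal
      (((p1 (fun y => u (H y)) x) ^ 2 + (p2 (fun y => u (H y)) x) ^ 2) * ϑ (H x)))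
      = ∫⁻ x : ℝ × ℝ, ENNReal.ofReal (g (x.1 ^ 2 + x.2 ^ 2)) := by
    refine lintegral_congr_ae ?_
    filter_upwards [Measure.ae_ne volume (0 : ℝ × ℝ)] with x hx
    have hpos : 0 < x.1 ^ 2 + x.2 ^ 2 := by
      by_contra hle
      refine hx (Prod.ext ?_ ?_)
      · exact pow_eq_zero_iff two_ne_zero |>.1 (by nlinarith [sq_nonneg x.1, sq_nonneg x.2])
      · exact pow_eq_zero_iff two_ne_zero |>.1 (by nlinarith [sq_nonneg x.1, sq_nonneg x.2])
    rw [hHeq, p1_comp_radial_sq (hwd _ hpos), p2_comp_radial_sq (hwd _ hpos), hH]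
    congr 1
    simp only [g]
    ring
  have hkd : ∀ r ∈ Ioi (0:ℝ), HasDerivWithinAt (fun r : ℝ => r ^ 2 + ζ (r ^ 2))
      ((1 + ζ' (r ^ 2)) * (2 * r)) (Ioi 0) r := fun r hr => by
    have h : HasDerivAt (fun t : ℝ => t ^ 2) (2 * r) r := by
      simpa using hasDerivAt_pow 2 r
    exact (HasDerivAt.comp (h := fun t : ℝ => t ^ 2) r
      (hqat (r ^ 2) (mem_Ioi.2 (pow_pos hr 2))) h).hasDerivWithinAt
  have hkinj : InjOn (fun r : ℝ => r ^ 2 + ζ (r ^ 2)) (Ioi 0) := fun a ha b hb hab =>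
    (pow_left_inj₀ (le_of_lt ha) (le_of_lt hb) two_ne_zero).1
      (hmono.injOn (sq_nonneg a) (sq_nonneg b) hab)
  have hkim : (fun r : ℝ => r ^ 2 + ζ (r ^ 2)) '' Ioi 0 = Ioi 0 := by
    ext z
    constructor
    · rintro ⟨r, hr, rfl⟩
      exact hq_pos (r ^ 2) (mem_Ioi.2 (pow_pos hr 2))
    · intro hz
      have hz0 : (0:ℝ) ≤ z := le_of_lt hz
      have hFz : 0 < F z := by
        refine lt_of_le_of_ne (hF0 z hz0) fun h => (mem_Ioi.1 hz).ne' ?_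
        rw [← hinv z hz0, ← h, hζ0, add_zero]
      refine ⟨√(F z), Real.sqrt_pos.2 hFz, ?_⟩
      simp only [Real.sq_sqrt hFz.le, hinv z hz0]
  rw [hlhs, lintegral_radial_sq (g := fun s => ENNReal.ofReal (g s)) hgm]
  conv_rhs => rw [← hkim, lintegral_image_eq_lintegral_abs_deriv_mul measurableSet_Ioi hkd hkinj]
  rw [← lintegral_const_mul' _ _ ENNReal.ofReal_ne_top,
    ← lintegral_const_mul' _ _ ENNReal.ofNat_ne_top]
  refine setLIntegral_congr_fun measurableSet_Ioi fun r hr => ?_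
  have hr0 : (0:ℝ) ≤ r := le_of_lt hr
  have hd := (hqpos _ (sq_nonneg r)).le
  have hdn : 0 ≤ (1 + ζ' (r ^ 2)) * (2 * r) := by positivity
  simp only [g]
  rw [abs_of_nonneg hdn, hA _ (hq_nonneg _ (sq_nonneg r)), hFq _ (sq_nonneg r),
    ← ENNReal.ofReal_mul hr0, ← ENNReal.ofReal_mul (by positivity), ← ENNReal.ofReal_mul hdn,
    ← ENNReal.ofReal_ofNat 2, ← ENNReal.ofReal_mul zero_le_two]
  congr 1
  ring
end

section
/- Let μ be a finite (nonnegative) Borel measure on ℝ². Suppose that for all θ₁, θ₂ ∈ [0, 2π), ∫_{ℝ²} |exp(−i(cos θ₁·ξ₁ + sin θ₁·ξ₂)) − exp(−i(cos θ₂·ξ₁ + sin θ₂·ξ₂))|² dμ(ξ) = 0. Then μ(ℝ² ∖ {0}) = 0, i.e. the support of μ is contained in {0}. -/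
open Set MeasureTheory

/-- If `θ ↦ exp (-i ⟨(cos θ, sin θ), ξ⟩)` is constant near `θ`, then `ξ` is orthogonal to the
tangent vector of the unit circle at `θ`. -/
theorem tangent_eq_zero_of_exp_eventually_const {ξ : ℝ × ℝ} {θ : ℝ} {c : ℂ}
    (h : ∀ᶠ t in nhds θ,
      Complex.exp (-Complex.I * ((Real.cos t * ξ.1 + Real.sin t * ξ.2 : ℝ) : ℂ)) = c) :
    -Real.sin θ * ξ.1 + Real.cos θ * ξ.2 = 0 := by
  have hg : HasDerivAt (fun t : ℝ => Real.cos t * ξ.1 + Real.sin t * ξ.2)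
      (-Real.sin θ * ξ.1 + Real.cos θ * ξ.2) θ :=
    ((Real.hasDerivAt_cos θ).mul_const _).add ((Real.hasDerivAt_sin θ).mul_const _)
  have hF := (hg.ofReal_comp.const_mul (-Complex.I)).cexp
  have h0 := hF.unique ((hasDerivAt_const θ c).congr_of_eventuallyEq h)
  simpa only [mul_eq_zero, Complex.exp_ne_zero, neg_eq_zero, Complex.I_ne_zero, false_or,
    Complex.ofReal_eq_zero] using h0

/-- The functions `ξ ↦ exp (-i ⟨x, ξ⟩)`, with `x` ranging over a dense set of points of the unit
circle, take a common value only at `ξ = 0`. -/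
theorem eq_zero_of_exp_eq_on_rat {ξ : ℝ × ℝ} {c : ℂ}
    (h : ∀ q : ℚ, (q : ℝ) ∈ Ioo 0 (2 * Real.pi) →
      Complex.exp (-Complex.I * ((Real.cos q * ξ.1 + Real.sin q * ξ.2 : ℝ) : ℂ)) = c) :
    ξ = 0 := by
  have hclosed : IsClosed {t : ℝ |
      Complex.exp (-Complex.I * ((Real.cos t * ξ.1 + Real.sin t * ξ.2 : ℝ) : ℂ)) = c} :=
    isClosed_eq (by fun_prop) continuous_const
  have hsub := (Rat.denseRange_cast (𝕜 := ℝ)).open_subset_closure_inter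
    (isOpen_Ioo (a := (0 : ℝ)) (b := 2 * Real.pi))
  have hconst := hsub.trans (hclosed.closure_subset_iff.2 (by
    rintro _ ⟨hq, q, rfl⟩
    exact h q hq))
  have hnear {t : ℝ} (ht : t ∈ Ioo 0 (2 * Real.pi)) :=
    tangent_eq_zero_of_exp_eventually_const
      (Filter.mem_of_superset (isOpen_Ioo.mem_nhds ht) hconst)
  have hpi := Real.pi_pos
  have h₁ := hnear (t := Real.pi / 2) ⟨by linarith, by linarith⟩
  have h₂ := hnear (t := Real.pi) ⟨by linarith, by linarith⟩
  ext
  · simpa using h₁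
  · simpa using h₂

theorem stmt_13 (μ : Measure (ℝ × ℝ)) [IsFiniteMeasure μ]
    (h : ∀ θ₁ ∈ Ico (0:ℝ) (2 * Real.pi), ∀ θ₂ ∈ Ico (0:ℝ) (2 * Real.pi),
      (∫ ξ : ℝ × ℝ,
        ‖Complex.exp (-Complex.I * ((Real.cos θ₁ * ξ.1 + Real.sin θ₁ * ξ.2 : ℝ) : ℂ))
          - Complex.exp
              (-Complex.I * ((Real.cos θ₂ * ξ.1 + Real.sin θ₂ * ξ.2 : ℝ) : ℂ))‖ ^ 2 ∂μ)
        = 0) :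
    μ {ξ : ℝ × ℝ | ξ ≠ 0} = 0 := by
  have hae : ∀ q : ℚ, (q : ℝ) ∈ Ioo 0 (2 * Real.pi) → ∀ᵐ ξ ∂μ,
      Complex.exp (-Complex.I * ((Real.cos q * ξ.1 + Real.sin q * ξ.2 : ℝ) : ℂ))
        = Complex.exp (-Complex.I * ((Real.cos 0 * ξ.1 + Real.sin 0 * ξ.2 : ℝ) : ℂ)) := by
    intro q hq
    have hint := h q ⟨hq.1.le, hq.2⟩ 0 ⟨le_rfl, Real.two_pi_pos⟩
    have hnorm (x : ℝ) : ‖Complex.exp (-Complex.I * (x : ℂ))‖ = 1 := by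
      simp [Complex.norm_exp]
    rw [integral_eq_zero_iff_of_nonneg (fun _ => by positivity)] at hint
    · filter_upwards [hint] with ξ hξ
      exact sub_eq_zero.1 (norm_eq_zero.1 (pow_eq_zero_iff two_ne_zero |>.1 hξ))
    · refine Integrable.of_bound (C := 2 ^ 2)
        (Continuous.aestronglyMeasurable (by fun_prop)) (ae_of_all _ fun ξ => ?_)
      rw [norm_pow, norm_norm]
      gcongr
      refine (norm_sub_le _ _).trans ?_
      rw [hnorm, hnorm]
      norm_num
  have hzero : ∀ᵐ ξ ∂μ, ξ = 0 := by
    filter_upwards [ae_all_iff.2 fun q : ℚ => Filter.eventually_imp_distrib_left.2 (hae q)] with ξ hξ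
    exact eq_zero_of_exp_eq_on_rat hξ
  exact hzero
end

section
/- Let H : ℝ² → ℝ be twice continuously differentiable, ϑ : ℝ → ℝ be continuously differentiable, and χ : ℝ² → ℝ be continuously differentiable with compact support. Then ∫_{ℝ²} ⟨∇⊥H(x), ∇χ(x)⟩·ϑ(H(x)) dx = 0, where ∇⊥H(x) := (−∂₂H(x), ∂₁H(x)). -/
open Set MeasureTheory

lemma p1_eq_fderiv {f : ℝ × ℝ → ℝ} (hf : Differentiable ℝ f) (x : ℝ × ℝ) :
    p1 f x = fderiv ℝ f x (1, 0) := by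
  have h : HasDerivAt (fun t : ℝ => (t, x.2)) ((1 : ℝ), (0 : ℝ)) x.1 :=
    (hasDerivAt_id x.1).prodMk (hasDerivAt_const x.1 x.2)
  exact ((hf x).hasFDerivAt.comp_hasDerivAt x.1 h).deriv

lemma p2_eq_fderiv {f : ℝ × ℝ → ℝ} (hf : Differentiable ℝ f) (x : ℝ × ℝ) :
    p2 f x = fderiv ℝ f x (0, 1) := by
  have h : HasDerivAt (fun t : ℝ => (x.1, t)) ((0 : ℝ), (1 : ℝ)) x.2 :=
    (hasDerivAt_const x.2 x.1).prodMk (hasDerivAt_id x.2)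
  exact ((hf x).hasFDerivAt.comp_hasDerivAt x.2 h).deriv

section

variable {E : Type*} [NormedAddCommGroup E] [NormedSpace ℝ E]

lemma contDiff_fderiv_apply_mul_comp {H : E → ℝ} {ϑ : ℝ → ℝ}
    (hH : ContDiff ℝ 2 H) (hϑ : ContDiff ℝ 1 ϑ) (v : E) :
    ContDiff ℝ 1 (fun x => fderiv ℝ H x v * ϑ (H x)) :=
  ((hH.fderiv_right (m := 1) (by norm_num)).clm_apply contDiff_const).mul
    (hϑ.comp (hH.of_le (by norm_num)))

/-- The one-form `ϑ(H) dH` is closed. -/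
lemma fderiv_fderiv_apply_mul_comp_comm {H : E → ℝ} {ϑ : ℝ → ℝ}
    (hH : ContDiff ℝ 2 H) (hϑ : ContDiff ℝ 1 ϑ) (v w x : E) :
    fderiv ℝ (fun y => fderiv ℝ H y v * ϑ (H y)) x w =
      fderiv ℝ (fun y => fderiv ℝ H y w * ϑ (H y)) x v := by
  have hd : HasFDerivAt H (fderiv ℝ H x) x := (hH.differentiable (by norm_num) x).hasFDerivAt
  have hd2 : HasFDerivAt (fderiv ℝ H) (fderiv ℝ (fderiv ℝ H) x) x :=
    ((hH.fderiv_right (m := 1) (by norm_num)).differentiable (by norm_num) x).hasFDerivAt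
  have hϑd : HasDerivAt ϑ (deriv ϑ (H x)) (H x) :=
    (hϑ.differentiable (by norm_num) (H x)).hasDerivAt
  have hsymm : IsSymmSndFDerivAt ℝ H x := hH.contDiffAt.isSymmSndFDerivAt (by simp)
  have key (u : E) :=
    ((hd2.clm_apply (hasFDerivAt_const u x)).mul (hϑd.comp_hasFDerivAt x hd)).fderiv
  have hv := congrArg (fun L => L w) (key v)
  have hw := congrArg (fun L => L v) (key w)
  refine hv.trans (Eq.trans ?_ hw.symm)
  simp [hsymm.eq v w]
  ring

variable [MeasurableSpace E] [BorelSpace E] {μ : Measure E} [μ.IsAddHaarMeasure]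

lemma integrable_mul_fderiv_apply {f χ : E → ℝ} (hf : Continuous f) (hχ : ContDiff ℝ 1 χ)
    (hsupp : HasCompactSupport χ) (v : E) :
    Integrable (fun x => f x * fderiv ℝ χ x v) μ :=
  (hf.mul ((hχ.continuous_fderiv (by norm_num)).clm_apply
    continuous_const)).integrable_of_hasCompactSupport (hsupp.fderiv_apply ℝ v).mul_left

lemma integral_mul_fderiv_apply_eq_neg [FiniteDimensional ℝ E] {f χ : E → ℝ} (hf : ContDiff ℝ 1 f)
    (hχ : ContDiff ℝ 1 χ) (hsupp : HasCompactSupport χ) (v : E) :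
    ∫ x, f x * fderiv ℝ χ x v ∂μ = -∫ x, fderiv ℝ f x v * χ x ∂μ :=
  integral_mul_fderiv_eq_neg_fderiv_mul_of_integrable
    ((((hf.continuous_fderiv (by norm_num)).clm_apply continuous_const).mul
      hχ.continuous).integrable_of_hasCompactSupport hsupp.mul_left)
    (integrable_mul_fderiv_apply hf.continuous hχ hsupp v)
    ((hf.continuous.mul hχ.continuous).integrable_of_hasCompactSupport hsupp.mul_left)
    (fun x _ => hf.differentiable (by norm_num) x)
    (fun x _ => hχ.differentiable (by norm_num) x)

end

theorem stmt_16 (H : ℝ × ℝ → ℝ) (ϑ : ℝ → ℝ) (χ : ℝ × ℝ → ℝ)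
    (hH : ContDiff ℝ 2 H) (hϑ : ContDiff ℝ 1 ϑ) (hχ : ContDiff ℝ 1 χ)
    (hsupp : HasCompactSupport χ) :
    ∫ x : ℝ × ℝ, ((-(p2 H x)) * p1 χ x + p1 H x * p2 χ x) * ϑ (H x) = 0 := by
  have hHd : Differentiable ℝ H := hH.differentiable (by norm_num)
  have hχd : Differentiable ℝ χ := hχ.differentiable (by norm_num)
  have hc := contDiff_fderiv_apply_mul_comp hH hϑ
  calc ∫ x : ℝ × ℝ, ((-(p2 H x)) * p1 χ x + p1 H x * p2 χ x) * ϑ (H x)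
      = ∫ x : ℝ × ℝ, ((fderiv ℝ H x (1, 0) * ϑ (H x)) * fderiv ℝ χ x (0, 1)
          - (fderiv ℝ H x (0, 1) * ϑ (H x)) * fderiv ℝ χ x (1, 0)) := by
        refine integral_congr_ae (.of_forall fun x => ?_)
        simp only [p1_eq_fderiv hHd, p2_eq_fderiv hHd, p1_eq_fderiv hχd, p2_eq_fderiv hχd]
        ring
    _ = 0 := by
        rw [integral_sub (integrable_mul_fderiv_apply (hc _).continuous hχ hsupp _)
            (integrable_mul_fderiv_apply (hc _).continuous hχ hsupp _),
          integral_mul_fderiv_apply_eq_neg (hc _) hχ hsupp,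
          integral_mul_fderiv_apply_eq_neg (hc _) hχ hsupp]
        simp only [fderiv_fderiv_apply_mul_comp_comm hH hϑ (1, 0) (0, 1), sub_self]
end
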